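/- arXiv:1603.00945 — 2 statements merged into one kernel-verified Lean document; each statement's English description precedes it below -/
import Mathlib

section
/- Let α > −1/2 and n ∈ ℤ⁺, let x_{n,0}^{(α)} < ⋯ < x_{n,n}^{(α)} be the Gegenbauer–Gauss points with Christoffel numbers ϖ_{n,i}^{(α)}, and for each i let ξ_{n,i}^{(α)} = 1/∏_{j≠i} (x_{n,i}^{(α)} − x_{n,j}^{(α)}) be the barycentric weights. Then each ϖ_{n,i}^{(α)} > 0 and there exists a nonzero real constant c, independent of i, such that ξ_{n,i}^{(α)} = c · (−1)^i · sin(arccos(x_{n,i}^{(α)})) · √(ϖ_{n,i}^{(α)}) for every i = 0, …, n. -/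
open Polynomial

theorem intervalIntegrable_one_sub_sq_rpow {s : ℝ} (hs : -1 < s) :
    IntervalIntegrable (fun t : ℝ => (1 - t ^ 2) ^ s) MeasureTheory.volume (-1) 1 := by
  have left : IntervalIntegrable (fun t : ℝ => (1 - t ^ 2) ^ s) MeasureTheory.volume (-1) 0 := by
    have h : IntervalIntegrable (fun t : ℝ => (1 - t) ^ s * (t + 1) ^ s)
        MeasureTheory.volume (-1) 0 := by
      refine IntervalIntegrable.continuousOn_mul ?_ ?_
      · simpa using (intervalIntegral.intervalIntegrable_rpow' (a := 0) (b := 1) hs).comp_add_right 1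
      · refine ContinuousOn.rpow_const (by fun_prop) fun t ht => Or.inl ?_
        rw [Set.uIcc_of_le (by norm_num)] at ht
        linarith [ht.2]
    refine h.congr fun t ht => ?_
    rw [Set.uIoc_of_le (by norm_num)] at ht
    rw [← Real.mul_rpow (by linarith [ht.2]) (by linarith [ht.1])]
    ring_nf
  have right : IntervalIntegrable (fun t : ℝ => (1 - t ^ 2) ^ s) MeasureTheory.volume 0 1 := by
    simpa using (IntervalIntegrable.comp_sub_left left 0).symm
  exact left.trans right

theorem intervalIntegrable_polynomial_mul_one_sub_sq_rpow {s : ℝ} (hs : -1 < s) (p : ℝ[X]) :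
    IntervalIntegrable (fun t : ℝ => p.eval t * (1 - t ^ 2) ^ s) MeasureTheory.volume (-1) 1 :=
  (intervalIntegrable_one_sub_sq_rpow hs).continuousOn_mul p.continuous.continuousOn

/-- Integration of polynomials against the Gegenbauer weight `(1 - t ^ 2) ^ (α - 1 / 2)`. -/
noncomputable def gegenbauerIntegral (α : ℝ) (hα : -1 / 2 < α) : ℝ[X] →ₗ[ℝ] ℝ where
  toFun p := ∫ t in (-1 : ℝ)..1, p.eval t * (1 - t ^ 2) ^ (α - 1 / 2)
  map_add' p q := by
    rw [← intervalIntegral.integral_add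
      (intervalIntegrable_polynomial_mul_one_sub_sq_rpow (by linarith) p)
      (intervalIntegrable_polynomial_mul_one_sub_sq_rpow (by linarith) q)]
    simp only [eval_add, add_mul]
  map_smul' c p := by
    simp only [eval_smul, smul_eq_mul, RingHom.id_apply, mul_assoc,
      intervalIntegral.integral_const_mul]

theorem gegenbauerIntegral_C_mul {α : ℝ} (hα : -1 / 2 < α) (c : ℝ) (p : ℝ[X]) :
    gegenbauerIntegral α hα (C c * p) = c * gegenbauerIntegral α hα p := by
  rw [← smul_eq_C_mul, map_smul, smul_eq_mul]

theorem gegenbauerIntegral_sq_pos {α : ℝ} (hα : -1 / 2 < α) {p : ℝ[X]} (hp : p ≠ 0) :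
    0 < gegenbauerIntegral α hα (p ^ 2) := by
  have hint := intervalIntegrable_polynomial_mul_one_sub_sq_rpow
    (s := α - 1 / 2) (by linarith) (p ^ 2)
  have hweight : ∀ t ∈ Set.Ioo (-1 : ℝ) 1, 0 < (1 - t ^ 2) ^ (α - 1 / 2) := fun t ht =>
    Real.rpow_pos_of_pos (by nlinarith [ht.1, ht.2]) _
  change 0 < ∫ t in (-1 : ℝ)..1, (p ^ 2).eval t * (1 - t ^ 2) ^ (α - 1 / 2)
  rw [intervalIntegral.integral_pos_iff_support_of_nonneg_ae' _ hint]
  · refine ⟨by norm_num, ?_⟩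
    have hsub : Set.Ioo (-1 : ℝ) 1 \ {t | p.IsRoot t} ⊆
        Function.support (fun t : ℝ => (p ^ 2).eval t * (1 - t ^ 2) ^ (α - 1 / 2)) ∩
          Set.Ioc (-1) 1 := by
      rintro t ⟨ht, hroot⟩
      refine ⟨?_, Set.Ioo_subset_Ioc_self ht⟩
      rw [Function.mem_support, eval_pow]
      exact mul_ne_zero (pow_ne_zero 2 hroot) (hweight t ht).ne'
    refine lt_of_lt_of_le ?_ (MeasureTheory.measure_mono hsub)
    rw [MeasureTheory.measure_sdiff_null
      ((Polynomial.finite_setOfPred_isRoot hp).measure_zero _), Real.volume_Ioo]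
    norm_num
  · rw [Set.uIoc_of_le (by norm_num)]
    refine (MeasureTheory.ae_restrict_iff' measurableSet_Ioc).2 (Filter.Eventually.of_forall ?_)
    intro t ht
    have : 0 ≤ 1 - t ^ 2 := by nlinarith [ht.1, ht.2]
    simp only [Pi.zero_apply, eval_pow]
    positivity

/-- The boundary terms vanish in the integral of the derivative of `p * (1 - t ^ 2) ^ (α + 1 / 2)`. -/
theorem gegenbauerIntegral_pearson {α : ℝ} (hα : -1 / 2 < α) (p : ℝ[X]) :
    gegenbauerIntegral α hα
      ((1 - X ^ 2) * derivative p - C (2 * α + 1) * (X * p)) = 0 := by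
  have hpos : 0 < α + 1 / 2 := by linarith
  have key := intervalIntegral.integral_eq_sub_of_hasDerivAt_of_le
    (a := -1) (b := 1) (f := fun t : ℝ => p.eval t * (1 - t ^ 2) ^ (α + 1 / 2))
    (f' := fun t : ℝ => ((1 - X ^ 2) * derivative p - C (2 * α + 1) * (X * p)).eval t *
      (1 - t ^ 2) ^ (α - 1 / 2)) (by norm_num)
    (p.continuous.mul
      ((by fun_prop : Continuous fun t : ℝ => 1 - t ^ 2).rpow_const
        fun _ => Or.inr hpos.le)).continuousOn
    ?_ (intervalIntegrable_polynomial_mul_one_sub_sq_rpow (by linarith) _)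
  · change (∫ t in (-1 : ℝ)..1, _) = _
    rw [key]
    norm_num [Real.zero_rpow hpos.ne']
  · intro t ht
    have hbase : 0 < 1 - t ^ 2 := by nlinarith [ht.1, ht.2]
    have hsq : HasDerivAt (fun t : ℝ => 1 - t ^ 2) (-(2 * t)) t := by
      simpa using (hasDerivAt_pow 2 t).const_sub 1
    refine ((p.hasDerivAt t).mul
      (hsq.rpow_const (p := α + 1 / 2) (Or.inl hbase.ne'))).congr_deriv ?_
    rw [show α + 1 / 2 - 1 = α - 1 / 2 by ring,
      show α + 1 / 2 = α - 1 / 2 + 1 by ring, Real.rpow_add_one hbase.ne']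
    simp only [eval_sub, eval_mul, eval_one, eval_pow, eval_X, eval_C]
    ring

section Recurrence

variable {α : ℝ} {G : ℕ → ℝ[X]}

theorem gegenbauer_derivative (hα : -1 / 2 < α) (hG0 : G 0 = 1) (hG1 : G 1 = X)
    (hGrec : ∀ k : ℕ, 1 ≤ k → C ((k : ℝ) + 2 * α) * G (k + 1) =
      C (2 * ((k : ℝ) + α)) * (X * G k) - C (k : ℝ) * G (k - 1)) (k : ℕ) :
    (1 - X ^ 2) * derivative (G k) = C ((k : ℝ) + 2 * α) * (X * G k - G (k + 1)) ∧
      (1 - X ^ 2) * derivative (G (k + 1)) = C ((k : ℝ) + 1) * (G k - X * G (k + 1)) := by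
  induction k with
  | zero => simp [hG0, hG1, sq]
  | succ k ih =>
    obtain ⟨hlower, hupper⟩ := ih
    have hrec := hGrec (k + 1) (by omega)
    have hne : ((k + 1 : ℕ) : ℝ) + 2 * α ≠ 0 := by
      have : (0 : ℝ) ≤ k := k.cast_nonneg
      push_cast
      linarith
    have hder := congrArg derivative hrec
    simp only [derivative_mul, derivative_sub, derivative_C, derivative_X, zero_mul, zero_add,
      one_mul, add_tsub_cancel_right] at hder hrec
    rw [← mul_right_inj' (C_ne_zero.2 hne) (b := (1 - X ^ 2) * derivative (G (k + 1 + 1)))]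
    simp only [C_add, C_mul, C_1, map_natCast, map_ofNat, Nat.cast_add, Nat.cast_one]
      at hrec hder hlower hupper ⊢
    constructor
    · linear_combination hupper + hrec
    · linear_combination (1 - X ^ 2) * hder + 2 * ((k : ℝ[X]) + 1 + C α) * X * hupper -
        ((k : ℝ[X]) + 1) * hlower + ((k : ℝ[X]) + 2) * X * hrec

theorem gegenbauerIntegral_gegenbauer_succ (hα : -1 / 2 < α) (hG0 : G 0 = 1) (hG1 : G 1 = X)
    (hGrec : ∀ k : ℕ, 1 ≤ k → C ((k : ℝ) + 2 * α) * G (k + 1) =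
      C (2 * ((k : ℝ) + α)) * (X * G k) - C (k : ℝ) * G (k - 1)) (k : ℕ) :
    gegenbauerIntegral α hα (G (k + 1)) = 0 := by
  induction k using Nat.twoStepInduction with
  | zero =>
    have h := gegenbauerIntegral_pearson hα 1
    rw [derivative_one, mul_zero, zero_sub, map_neg, gegenbauerIntegral_C_mul, mul_one] at h
    have hne : 2 * α + 1 ≠ 0 := by linarith
    simpa [hG1, hne] using h
  | one =>
    have h := gegenbauerIntegral_pearson hα (G 1)
    have hrec := congrArg (gegenbauerIntegral α hα) (hGrec 1 le_rfl)
    have hder := (gegenbauer_derivative hα hG0 hG1 hGrec 0).2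
    simp only [zero_add] at hder
    rw [hder] at h
    simp only [mul_sub, map_sub, gegenbauerIntegral_C_mul] at h hrec
    norm_num at h hrec ⊢
    have h1 : 1 + 2 * α ≠ 0 := by linarith
    have h2 : 2 + 2 * α ≠ 0 := by linarith
    apply (mul_eq_zero_iff_left h2).1
    apply (mul_eq_zero_iff_left h1).1
    linear_combination (2 + 2 * α) * hrec - (2 + 2 * α) * h
  | more k ih _ =>
    have h := gegenbauerIntegral_pearson hα (G (k + 1 + 1))
    have hrec := congrArg (gegenbauerIntegral α hα) (hGrec (k + 1 + 1) (by omega))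
    rw [(gegenbauer_derivative hα hG0 hG1 hGrec (k + 1)).2] at h
    simp only [mul_sub, map_sub, gegenbauerIntegral_C_mul, add_tsub_cancel_right, ih] at h hrec
    push_cast at h hrec
    have hk : (0 : ℝ) ≤ k := k.cast_nonneg
    have h1 : (k : ℝ) + 2 + 2 * α ≠ 0 := by linarith
    have h2 : (k : ℝ) + 3 + 2 * α ≠ 0 := by linarith
    apply (mul_eq_zero_iff_left h2).1
    apply (mul_eq_zero_iff_left h1).1
    linear_combination ((k : ℝ) + 3 + 2 * α) * hrec - 2 * ((k : ℝ) + 2 + α) * h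

theorem gegenbauerIntegral_mul_X_pow (hα : -1 / 2 < α) (hG0 : G 0 = 1) (hG1 : G 1 = X)
    (hGrec : ∀ k : ℕ, 1 ≤ k → C ((k : ℝ) + 2 * α) * G (k + 1) =
      C (2 * ((k : ℝ) + α)) * (X * G k) - C (k : ℝ) * G (k - 1)) {j k : ℕ} (hjk : j < k) :
    gegenbauerIntegral α hα (G k * X ^ j) = 0 := by
  induction j generalizing k with
  | zero =>
    obtain ⟨k, rfl⟩ := Nat.exists_eq_succ_of_ne_zero hjk.ne'
    simpa using gegenbauerIntegral_gegenbauer_succ hα hG0 hG1 hGrec k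
  | succ j ih =>
    have hrec := congrArg (fun p => gegenbauerIntegral α hα (p * X ^ j)) (hGrec k (by omega))
    have hk : (1 : ℝ) ≤ k := by exact_mod_cast (by omega : 1 ≤ k)
    have hne : 2 * ((k : ℝ) + α) ≠ 0 := by linarith
    simp only [sub_mul, mul_assoc, map_sub, gegenbauerIntegral_C_mul,
      ih (show j < k + 1 by omega), ih (show j < k - 1 by omega)] at hrec
    rw [show G k * X ^ (j + 1) = X * (G k * X ^ j) by ring]
    apply (mul_eq_zero_iff_left hne).1
    linear_combination -hrec

theorem gegenbauer_natDegree_le (hα : -1 / 2 < α) (hG0 : G 0 = 1) (hG1 : G 1 = X)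
    (hGrec : ∀ k : ℕ, 1 ≤ k → C ((k : ℝ) + 2 * α) * G (k + 1) =
      C (2 * ((k : ℝ) + α)) * (X * G k) - C (k : ℝ) * G (k - 1)) (k : ℕ) :
    (G k).natDegree ≤ k := by
  induction k using Nat.twoStepInduction with
  | zero => simp [hG0]
  | one => simp [hG1]
  | more k ih₀ ih₁ =>
    have hrec := hGrec (k + 1) (by omega)
    have hne : ((k + 1 : ℕ) : ℝ) + 2 * α ≠ 0 := by
      have : (0 : ℝ) ≤ k := k.cast_nonneg
      push_cast
      linarith
    rw [← natDegree_C_mul hne, hrec, add_tsub_cancel_right]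
    refine (natDegree_sub_le _ _).trans (max_le ?_ ?_)
    · refine (natDegree_C_mul_le _ _).trans (natDegree_mul_le.trans ?_)
      rw [natDegree_X]
      omega
    · exact (natDegree_C_mul_le _ _).trans (by omega)

end Recurrence

theorem gegenbauerIntegral_mul_eq_zero {α : ℝ} (hα : -1 / 2 < α) {P : ℝ[X]} {n : ℕ}
    (horth : ∀ j ≤ n, gegenbauerIntegral α hα (P * X ^ j) = 0) {p : ℝ[X]}
    (hp : p.natDegree ≤ n) : gegenbauerIntegral α hα (P * p) = 0 := by
  rw [p.as_sum_range_C_mul_X_pow' (Nat.lt_succ_of_le hp), Finset.mul_sum, map_sum]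
  refine Finset.sum_eq_zero fun j hj => ?_
  rw [mul_left_comm, gegenbauerIntegral_C_mul, horth j (by simpa [Nat.lt_succ_iff] using hj), mul_zero]

/-- The integral of `(P / (X - a)) ^ 2`, where `a` is a root of the monic orthogonal
polynomial `P` of degree `n + 1`. -/
theorem gegenbauerIntegral_sq_div_root {α : ℝ} (hα : -1 / 2 < α) {q : ℝ[X]} {a : ℝ} {n : ℕ}
    (hmonic : q.Monic) (hdeg : q.natDegree = n)
    (horth : ∀ p : ℝ[X], p.natDegree ≤ n →
      gegenbauerIntegral α hα ((X - C a) * q * p) = 0) :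
    (1 - a ^ 2) * gegenbauerIntegral α hα (q ^ 2) =
      (2 * n + 2 * α + 2) * gegenbauerIntegral α hα (((X - C a) * q) ^ 2) := by
  set P := (X - C a) * q with hP
  have hPmonic : P.Monic := (monic_X_sub_C a).mul hmonic
  have hPdeg : P.natDegree = n + 1 := by
    rw [hP, (monic_X_sub_C a).natDegree_mul hmonic, natDegree_X_sub_C, hdeg, add_comm]
  have hq : gegenbauerIntegral α hα (P * q) = 0 := horth q hdeg.le
  have hXq : gegenbauerIntegral α hα (P * (X * q)) = gegenbauerIntegral α hα (P ^ 2) := by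
    rw [show P * (X * q) = P ^ 2 + C a * (P * q) by rw [hP]; ring, map_add,
      gegenbauerIntegral_C_mul, hq, mul_zero, add_zero]
  have hder : gegenbauerIntegral α hα (P * ((1 - X ^ 2) * derivative q)) =
      -n * gegenbauerIntegral α hα (P ^ 2) := by
    have hlow : ((1 - X ^ 2) * derivative q + C (n : ℝ) * P).natDegree ≤ n := by
      rw [natDegree_le_iff_coeff_eq_zero]
      intro N hN
      obtain ⟨m, rfl⟩ := Nat.exists_eq_succ_of_ne_zero (Nat.ne_zero_of_lt hN)
      rw [Nat.succ_eq_add_one] at hN ⊢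
      have hXder : (X * derivative q).coeff m = m * q.coeff m := by
        rcases m with _ | m
        · simp
        · rw [coeff_X_mul, coeff_derivative]
          push_cast
          ring
      rw [sub_mul, one_mul, sq, mul_assoc, coeff_add, coeff_sub, coeff_X_mul, coeff_C_mul, hXder,
        coeff_derivative, coeff_eq_zero_of_natDegree_lt (p := q) (n := m + 1 + 1) (by omega)]
      obtain rfl | hlt := (Nat.lt_succ_iff.1 hN).eq_or_lt
      · have h₁ : q.coeff n = 1 := hdeg ▸ hmonic.coeff_natDegree
        have h₂ : P.coeff (n + 1) = 1 := hPdeg ▸ hPmonic.coeff_natDegree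
        rw [h₁, h₂]
        ring
      · rw [coeff_eq_zero_of_natDegree_lt (p := q) (n := m) (by omega),
          coeff_eq_zero_of_natDegree_lt (p := P) (n := m + 1) (by omega)]
        ring
    have h := horth _ hlow
    rw [mul_add, map_add, mul_left_comm P (C _), gegenbauerIntegral_C_mul, ← sq] at h
    linarith
  have hpearson := gegenbauerIntegral_pearson hα (q * P)
  have hdP : derivative P = q + (X - C a) * derivative q := by
    simp [hP, derivative_mul]
  rw [derivative_mul, hdP,
    show (1 - X ^ 2) * (derivative q * P + q * (q + (X - C a) * derivative q)) -
      C (2 * α + 1) * (X * (q * P)) = (1 - X ^ 2) * q ^ 2 +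
        C 2 * (P * ((1 - X ^ 2) * derivative q)) - C (2 * α + 1) * (P * (X * q)) by
      rw [hP, C_ofNat]; ring,
    map_sub, map_add, gegenbauerIntegral_C_mul, gegenbauerIntegral_C_mul, hder, hXq] at hpearson
  rw [← gegenbauerIntegral_C_mul,
    show C (1 - a ^ 2) * q ^ 2 = (1 - X ^ 2) * q ^ 2 + P ^ 2 + C (2 * a) * (P * q) by
      rw [hP]; simp only [C_sub, C_mul, C_pow, C_1, C_ofNat]; ring,
    map_add, map_add, gegenbauerIntegral_C_mul, hq]
  linear_combination hpearson

open Finset in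
/-- Barycentric weights of increasing nodes alternate in sign. -/
theorem neg_one_pow_mul_prod_sub_pos {n : ℕ} {x : Fin (n + 1) → ℝ} (hx : StrictMono x)
    (i : Fin (n + 1)) :
    0 < (-1 : ℝ) ^ n * (-1) ^ (i : ℕ) * ∏ j ∈ univ.erase i, (x i - x j) := by
  have hsplit : univ.erase i = Iio i ∪ Ioi i := by
    ext j
    simp [lt_or_lt_iff_ne]
  have hdisj : Disjoint (Iio i) (Ioi i) :=
    disjoint_left.2 fun j hj hj' => lt_asymm (mem_Iio.1 hj) (mem_Ioi.1 hj')
  have hupper : ∏ j ∈ Ioi i, (x i - x j) = (-1) ^ (n - (i : ℕ)) * ∏ j ∈ Ioi i, (x j - x i) := by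
    rw [show n - (i : ℕ) = #(Ioi i) by simp [Fin.card_Ioi], ← prod_const, ← prod_mul_distrib]
    exact prod_congr rfl fun _ _ => by ring
  have hsign : (-1 : ℝ) ^ n * (-1) ^ (i : ℕ) * (-1) ^ (n - (i : ℕ)) = 1 := by
    rw [mul_assoc, ← pow_add, Nat.add_sub_cancel' (Nat.lt_succ_iff.1 i.2), ← mul_pow]
    simp
  have h₁ : 0 < ∏ j ∈ Iio i, (x i - x j) :=
    prod_pos fun j hj => sub_pos.2 (hx (mem_Iio.1 hj))
  have h₂ : 0 < ∏ j ∈ Ioi i, (x j - x i) :=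
    prod_pos fun j hj => sub_pos.2 (hx (mem_Ioi.1 hj))
  rw [hsplit, prod_union hdisj, hupper]
  calc 0 < (∏ j ∈ Iio i, (x i - x j)) * ∏ j ∈ Ioi i, (x j - x i) := mul_pos h₁ h₂
    _ = _ := by linear_combination -((∏ j ∈ Iio i, (x i - x j)) * ∏ j ∈ Ioi i, (x j - x i)) * hsign

/-- The quadrature weight of a node expressed through the integral of a square. -/
theorem gegenbauerIntegral_mul_eq_sq {α : ℝ} (hα : -1 / 2 < α) {q : ℝ[X]} {a : ℝ} {n : ℕ}
    (hdeg : q.natDegree ≤ n)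
    (horth : ∀ p : ℝ[X], p.natDegree ≤ n →
      gegenbauerIntegral α hα ((X - C a) * q * p) = 0) :
    gegenbauerIntegral α hα (q ^ 2) = q.eval a * gegenbauerIntegral α hα q := by
  have hdvd := mul_divByMonic_eq_iff_isRoot (p := q - C (q.eval a)) (a := a)
  have hr : (X - C a) * ((q - C (q.eval a)) /ₘ (X - C a)) = q - C (q.eval a) :=
    hdvd.2 (by simp)
  have h := horth ((q - C (q.eval a)) /ₘ (X - C a)) (by
    rw [natDegree_divByMonic _ (monic_X_sub_C a), natDegree_sub_C]
    omega)
  rw [mul_right_comm, hr, sub_mul, map_sub, gegenbauerIntegral_C_mul, ← sq] at h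
  linarith


/-- **Explicit barycentric weights for the Gegenbauer–Gauss points.**
For `α > -1/2` and `n ∈ ℤ⁺`, letting `x 0 < ⋯ < x n` be the Gegenbauer–Gauss points
(the zeros of the standardized Gegenbauer polynomial `G (n+1)`), `w i` the corresponding
Christoffel numbers and `ξ i = 1 / ∏_{j ≠ i} (x i - x j)` the barycentric weights, every
`w i` is positive and there is a nonzero constant `c`, independent of `i`, with
`ξ i = c * (-1)^i * sin(arccos(x i)) * √(w i)` for all `i`. -/
theorem barycentric_weights_GG_sin_arccos_form
    (α : ℝ) (hα : -1/2 < α) (n : ℕ) (hn : 1 ≤ n)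
    (G : ℕ → Polynomial ℝ)
    (hG0 : G 0 = 1) (hG1 : G 1 = Polynomial.X)
    (hGrec : ∀ k : ℕ, 1 ≤ k →
      Polynomial.C ((k : ℝ) + 2 * α) * G (k + 1) =
        Polynomial.C (2 * ((k : ℝ) + α)) * (Polynomial.X * G k) -
          Polynomial.C (k : ℝ) * G (k - 1))
    (x : Fin (n + 1) → ℝ)
    (hx_mono : StrictMono x)
    (hx_mem : ∀ i, x i ∈ Set.Ioo (-1 : ℝ) 1)
    (hx_root : ∀ y : ℝ, (G (n + 1)).eval y = 0 ↔ ∃ i, y = x i)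
    (L : Fin (n + 1) → Polynomial ℝ)
    (hL_deg : ∀ k, (L k).natDegree ≤ n)
    (hL_eval : ∀ k j, (L k).eval (x j) = if j = k then (1 : ℝ) else 0)
    (w : Fin (n + 1) → ℝ)
    (hw : ∀ k, w k = ∫ t in (-1 : ℝ)..1, (L k).eval t * (1 - t ^ 2) ^ (α - 1/2))
    (ξ : Fin (n + 1) → ℝ)
    (hξ : ∀ i, ξ i = 1 / ∏ j ∈ Finset.univ.erase i, (x i - x j)) :
    (∀ i, 0 < w i) ∧
      ∃ c : ℝ, c ≠ 0 ∧
        ∀ i, ξ i = c * (-1 : ℝ) ^ (i : ℕ) *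
          (Real.sin (Real.arccos (x i)) * Real.sqrt (w i)) := by
  have hinj : Function.Injective x := hx_mono.injective
  set q : Fin (n + 1) → ℝ[X] := fun i => ∏ j ∈ Finset.univ.erase i, (X - C (x j)) with hq
  set P : ℝ[X] := ∏ j, (X - C (x j)) with hP
  have hqP (i) : (X - C (x i)) * q i = P :=
    Finset.mul_prod_erase Finset.univ (fun j => X - C (x j)) (Finset.mem_univ i)
  have hqmonic (i) : (q i).Monic := monic_prod_X_sub_C _ _
  have hqdeg (i) : (q i).natDegree = n := by
    simp [hq, natDegree_prod_of_monic _ _ fun j _ => monic_X_sub_C (x j)]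
  have hqeval (i) : (q i).eval (x i) = ∏ j ∈ Finset.univ.erase i, (x i - x j) := by
    simp [hq, eval_prod]
  have hqne (i) : (q i).eval (x i) ≠ 0 := by
    rw [hqeval, Finset.prod_ne_zero_iff]
    exact fun j hj => sub_ne_zero.2 (hinj.ne (Finset.ne_of_mem_erase hj).symm)
  have hPmonic : P.Monic := monic_prod_X_sub_C _ _
  have hPdeg : P.natDegree = n + 1 := by
    simp [hP, natDegree_prod_of_monic _ _ fun j _ => monic_X_sub_C (x j)]
  have hGne : G (n + 1) ≠ 0 := by
    intro h
    obtain ⟨i, hi⟩ := (hx_root 2).1 (by simp [h])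
    linarith [(hx_mem i).2]
  obtain ⟨r, hr⟩ : P ∣ G (n + 1) :=
    Finset.prod_dvd_of_coprime
      (fun i _ j _ hij => pairwise_coprime_X_sub_C hinj hij)
      (fun i _ => dvd_iff_isRoot.2 ((hx_root (x i)).2 ⟨i, rfl⟩))
  have hrne : r ≠ 0 := by
    rintro rfl
    exact hGne (by rw [hr, mul_zero])
  have hrdeg : r.natDegree = 0 := by
    have h := gegenbauer_natDegree_le hα hG0 hG1 hGrec (n + 1)
    rw [hr, hPmonic.natDegree_mul' hrne, hPdeg] at h
    omega
  obtain ⟨a, rfl⟩ := natDegree_eq_zero.1 hrdeg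
  have ha : a ≠ 0 := C_ne_zero.1 hrne
  have horth (p : ℝ[X]) (hp : p.natDegree ≤ n) : gegenbauerIntegral α hα (P * p) = 0 := by
    refine gegenbauerIntegral_mul_eq_zero hα (fun j hj => ?_) hp
    have h := gegenbauerIntegral_mul_X_pow hα hG0 hG1 hGrec (Nat.lt_succ_of_le hj)
    rw [Nat.succ_eq_add_one, hr, mul_comm P, mul_assoc, gegenbauerIntegral_C_mul] at h
    exact (mul_eq_zero_iff_left ha).1 h
  have hξq (i) : ξ i * (q i).eval (x i) = 1 := by
    rw [hξ, ← hqeval, one_div_mul_cancel (hqne i)]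
  have hL (i) : L i = C (ξ i) * q i := by
    refine eq_of_degrees_lt_of_eval_index_eq Finset.univ (v := x) hinj.injOn ?_ ?_ fun j _ => ?_
    · refine degree_le_natDegree.trans_lt ?_
      rw [Finset.card_fin]
      exact_mod_cast Nat.lt_succ_of_le (hL_deg i)
    · refine degree_le_natDegree.trans_lt ?_
      rw [Finset.card_fin]
      exact_mod_cast Nat.lt_succ_of_le ((natDegree_C_mul_le _ _).trans (hqdeg i).le)
    · rw [hL_eval, eval_mul, eval_C]
      split_ifs with hji
      · rw [hji, hξq]
      · rw [show (q i).eval (x j) = 0 by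
          simp only [hq, eval_prod]
          exact Finset.prod_eq_zero (Finset.mem_erase.2 ⟨hji, Finset.mem_univ j⟩) (by simp),
          mul_zero]
  have hw' (i) : w i = ξ i ^ 2 * gegenbauerIntegral α hα (q i ^ 2) := by
    have h1 : w i = ξ i * gegenbauerIntegral α hα (q i) := by
      rw [hw, ← gegenbauerIntegral_C_mul, ← hL]
      rfl
    rw [h1, gegenbauerIntegral_mul_eq_sq hα (hqdeg i).le (by rw [hqP]; exact horth)]
    linear_combination -(ξ i * gegenbauerIntegral α hα (q i)) * hξq i
  have hξne (i) : ξ i ≠ 0 := left_ne_zero_of_mul_eq_one (hξq i)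
  have hwpos (i) : 0 < w i := by
    rw [hw']
    exact mul_pos (by have := hξne i; positivity)
      (gegenbauerIntegral_sq_pos hα (hqmonic i).ne_zero)
  refine ⟨hwpos, ?_⟩
  set K := (2 * n + 2 * α + 2) * gegenbauerIntegral α hα (P ^ 2) with hK
  have hKpos : 0 < K :=
    mul_pos (by have : (0 : ℝ) ≤ n := n.cast_nonneg; linarith)
      (gegenbauerIntegral_sq_pos hα hPmonic.ne_zero)
  refine ⟨(-1) ^ n / √K, by have := Real.sqrt_pos.2 hKpos; positivity, fun i => ?_⟩
  have hsq := gegenbauerIntegral_sq_div_root hα (hqmonic i) (hqdeg i) (by rw [hqP]; exact horth)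
  rw [hqP, ← hK] at hsq
  have hbase : 0 ≤ 1 - x i ^ 2 := by nlinarith [(hx_mem i).1, (hx_mem i).2]
  have hsign : |ξ i| = (-1) ^ n * (-1) ^ (i : ℕ) * ξ i := by
    have h := neg_one_pow_mul_prod_sub_pos hx_mono i
    rw [← hqeval] at h
    have hpos : 0 < (-1) ^ n * (-1) ^ (i : ℕ) * ξ i := by
      refine pos_of_mul_pos_left (b := (q i).eval (x i) ^ 2) ?_ (sq_nonneg _)
      rwa [show (-1) ^ n * (-1) ^ (i : ℕ) * ξ i * (q i).eval (x i) ^ 2 =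
        (-1) ^ n * (-1) ^ (i : ℕ) * (q i).eval (x i) by
          linear_combination ((-1) ^ n * (-1) ^ (i : ℕ) * (q i).eval (x i)) * hξq i]
    rw [← abs_of_pos hpos]
    simp [abs_mul]
  have hroot : √(1 - x i ^ 2) * √(w i) = √K * |ξ i| := by
    rw [← Real.sqrt_mul hbase, ← Real.sqrt_sq_eq_abs, ← Real.sqrt_mul hKpos.le, hw', ← hsq]
    congr 1
    ring
  rw [Real.sin_arccos, hroot, hsign]
  have hne : √K ≠ 0 := (Real.sqrt_pos.2 hKpos).ne'
  have h1 : ((-1 : ℝ) ^ n) ^ 2 = 1 := by rw [← pow_mul, mul_comm, pow_mul]; simp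
  have h2 : ((-1 : ℝ) ^ (i : ℕ)) ^ 2 = 1 := by rw [← pow_mul, mul_comm, pow_mul]; simp
  field_simp
  rw [h1, h2]
  ring
end

section
/- Let −1/2 < α < 0 and let f ∈ C^∞[−1, 1] satisfy ‖f^{(n+1)}‖_{L^∞[−1,1]} ≤ A for all n ∈ ℤ⁺, where A > 0 is independent of n. For each n let x_{n,0}^{(α)} < ⋯ < x_{n,n}^{(α)} be the Gegenbauer–Gauss points with Lagrange basis polynomials ℒ_{n,i}^{(α)}, and set p_{B,j,i} = ∫_{−1}^{x_{n,j}^{(α)}} ℒ_{n,i}^{(α)}(x) dx. Then there exist a constant B > 0 and an integer n₀ such that for all n ≥ n₀ and all j ∈ {0, …, n}: |∫_{−1}^{x_{n,j}^{(α)}} f(x) dx − Σ_{i=0}^{n} p_{B,j,i} f(x_{n,i}^{(α)})| ≤ B · (e/2)^n · (x_{n,j}^{(α)} + 1) · n^{−n − 3/2}. -/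
theorem exists_iteratedDerivWithin_eq_zero_of_strictMono {a b : ℝ} (hab : a < b) (n : ℕ)
    (g : ℝ → ℝ) (hg : ContDiffOn ℝ n g (Set.Icc a b)) (z : Fin (n + 1) → ℝ) (hz : StrictMono z)
    (hz_mem : ∀ i, z i ∈ Set.Icc a b) (hgz : ∀ i, g (z i) = 0) :
    ∃ ξ ∈ Set.Icc a b, iteratedDerivWithin n g (Set.Icc a b) ξ = 0 := by
  induction n generalizing g with
  | zero => exact ⟨z 0, hz_mem 0, by simpa using hgz 0⟩
  | succ n ih =>
    have hrolle : ∀ i : Fin (n + 1), ∃ c ∈ Set.Ioo (z i.castSucc) (z i.succ), deriv g c = 0 :=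
      fun i ↦ exists_deriv_eq_zero (hz i.castSucc_lt_succ)
        (hg.continuousOn.mono (Set.Icc_subset_Icc (hz_mem _).1 (hz_mem _).2))
        ((hgz _).trans (hgz _).symm)
    choose c hc hcd using hrolle
    have hc_mem : ∀ i, c i ∈ Set.Ioo a b := fun i ↦
      ⟨(hz_mem _).1.trans_lt (hc i).1, (hc i).2.trans_le (hz_mem _).2⟩
    obtain ⟨ξ, hξ, h⟩ := ih (derivWithin g (Set.Icc a b))
      (hg.derivWithin (uniqueDiffOn_Icc hab) (by norm_cast)) c
      (Fin.strictMono_iff_lt_succ.2 fun i ↦ by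
        have h₁ := (hc i.castSucc).2
        have h₂ := (hc i.succ).1
        rw [Fin.succ_castSucc] at h₁
        exact h₁.trans h₂)
      (fun i ↦ Set.Ioo_subset_Icc_self (hc_mem i))
      (fun i ↦ by
        rw [derivWithin_of_mem_nhds (Icc_mem_nhds (hc_mem i).1 (hc_mem i).2), hcd])
    exact ⟨ξ, hξ, by rw [iteratedDerivWithin_succ', h]⟩

theorem Polynomial.iteratedDerivWithin_eval (p : Polynomial ℝ) (k : ℕ) {s : Set ℝ}
    (hs : UniqueDiffOn ℝ s) {t : ℝ} (ht : t ∈ s) :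
    iteratedDerivWithin k (fun y ↦ p.eval y) s t = (Polynomial.derivative^[k] p).eval t := by
  induction k generalizing t with
  | zero => simp
  | succ k ih =>
    rw [iteratedDerivWithin_succ, derivWithin_congr (fun y hy ↦ ih hy) (ih ht),
      Polynomial.derivWithin _ (hs t ht), Function.iterate_succ_apply']

theorem exists_sub_eval_eq_iteratedDerivWithin_mul_nodal {a b : ℝ} (hab : a < b) (n : ℕ)
    (f : ℝ → ℝ) (hf : ContDiffOn ℝ (n + 1 : ℕ) f (Set.Icc a b)) (x : Fin (n + 1) → ℝ)
    (hx : Function.Injective x) (hx_mem : ∀ i, x i ∈ Set.Icc a b) (p : Polynomial ℝ)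
    (hp : p.natDegree ≤ n) (hpx : ∀ i, p.eval (x i) = f (x i)) {t : ℝ} (ht : t ∈ Set.Icc a b) :
    ∃ ξ ∈ Set.Icc a b, (f t - p.eval t) * (n + 1).factorial =
      iteratedDerivWithin (n + 1) f (Set.Icc a b) ξ *
        (Lagrange.nodal Finset.univ x).eval t := by
  by_cases htx : ∃ i, x i = t
  · obtain ⟨i, rfl⟩ := htx
    exact ⟨x i, ht, by
      rw [hpx, Lagrange.eval_nodal_at_node (Finset.mem_univ i)]; simp⟩
  have htx' : ∀ i ∈ Finset.univ, t ≠ x i := fun i _ h ↦ htx ⟨i, h.symm⟩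
  have hN : (Lagrange.nodal Finset.univ x).eval t ≠ 0 := Lagrange.eval_nodal_not_at_node htx'
  set N := Lagrange.nodal Finset.univ x with hNdef
  set c : ℝ := (f t - p.eval t) / N.eval t with hc
  set q : Polynomial ℝ := p + Polynomial.C c * N with hq
  have hq_smooth : ContDiff ℝ (n + 1 : ℕ) (fun y ↦ q.eval y) := by
    simpa using q.contDiff_aeval (𝕜 := ℝ) ((n + 1 : ℕ) : WithTop ℕ∞)
  have hqx : ∀ i, q.eval (x i) = f (x i) := fun i ↦ by
    simp [hq, hpx, hNdef, Lagrange.eval_nodal_at_node]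
  have hqt : q.eval t = f t := by
    simp only [hq, Polynomial.eval_add, Polynomial.eval_mul, Polynomial.eval_C, hc]
    field_simp
    ring
  have hNdeg : N.natDegree = n + 1 := by simp [hNdef, Lagrange.natDegree_nodal]
  have hqd : ∀ y, (Polynomial.derivative^[n + 1] q).eval y = c * (n + 1).factorial := fun y ↦ by
    have h1 : Polynomial.derivative^[n + 1] p = 0 :=
      Polynomial.iterate_derivative_eq_zero (Nat.lt_succ_of_le hp)
    have h2 : Polynomial.derivative^[n + 1] N = Polynomial.C ((n + 1).factorial : ℝ) := by
      rw [Polynomial.eq_C_of_natDegree_le_zero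
        ((Polynomial.natDegree_iterate_derivative N (n + 1)).trans (by simp [hNdeg])),
        Polynomial.coeff_iterate_derivative, zero_add, Nat.descFactorial_self, ← hNdeg,
        Polynomial.coeff_natDegree, (Lagrange.nodal_monic).leadingCoeff]
      simp
    rw [hq, iterate_map_add Polynomial.derivative, Polynomial.iterate_derivative_C_mul, h1, h2]
    simp
  set s : Finset ℝ := insert t (Finset.univ.image x) with hs
  have hs_card : s.card = n + 1 + 1 := by
    rw [hs, Finset.card_insert_of_notMem (by simpa using htx),
      Finset.card_image_of_injective _ hx]
    simp
  have hs_mem : ∀ y ∈ s, y ∈ Set.Icc a b ∧ f y - q.eval y = 0 := by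
    intro y hy
    rcases Finset.mem_insert.1 hy with rfl | hy
    · exact ⟨ht, by rw [hqt, sub_self]⟩
    · obtain ⟨i, -, rfl⟩ := Finset.mem_image.1 hy
      exact ⟨hx_mem i, by rw [hqx, sub_self]⟩
  obtain ⟨ξ, hξ, h⟩ := exists_iteratedDerivWithin_eq_zero_of_strictMono hab (n + 1)
    (f - fun y ↦ q.eval y) (hf.sub hq_smooth.contDiffOn) (s.orderEmbOfFin hs_card)
    (s.orderEmbOfFin hs_card).strictMono
    (fun i ↦ (hs_mem _ (s.orderEmbOfFin_mem hs_card i)).1)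
    (fun i ↦ (hs_mem _ (s.orderEmbOfFin_mem hs_card i)).2)
  refine ⟨ξ, hξ, ?_⟩
  rw [iteratedDerivWithin_sub hξ (uniqueDiffOn_Icc hab) (hf ξ hξ)
    (hq_smooth.contDiffOn.contDiffWithinAt hξ), Polynomial.iteratedDerivWithin_eval q _
    (uniqueDiffOn_Icc hab) hξ, hqd, sub_eq_zero] at h
  · rw [h, hc]
    field_simp

open Polynomial in
/-- The three-term recurrence of the standardized Gegenbauer polynomials, with `G n 1 = 1`. -/
structure IsGegenbauer (α : ℝ) (G : ℕ → Polynomial ℝ) : Prop where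
  zero : G 0 = 1
  one : G 1 = X
  recurrence : ∀ k : ℕ, 1 ≤ k → C ((k : ℝ) + 2 * α) * G (k + 1) =
    C (2 * ((k : ℝ) + α)) * (X * G k) - C (k : ℝ) * G (k - 1)

namespace IsGegenbauer

open Polynomial

variable {α : ℝ} {G : ℕ → Polynomial ℝ}

theorem add_two (hG : IsGegenbauer α G) (k : ℕ) : ((k : ℝ[X]) + 1 + 2 * C α) * G (k + 2) =
    2 * ((k : ℝ[X]) + 1 + C α) * (X * G (k + 1)) - ((k : ℝ[X]) + 1) * G k := by
  have h := hG.recurrence (k + 1) (by omega)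
  simpa [C_ofNat] using h

theorem add_two_mul_ne_zero (hα : -1/2 < α) (k : ℕ) : (k : ℝ[X]) + 1 + 2 * C α ≠ 0 := by
  have h : (k : ℝ) + 1 + 2 * α ≠ 0 := by
    have := Nat.cast_nonneg (α := ℝ) k
    linarith
  intro h0
  apply h
  have := congrArg (eval 0) h0
  simpa using this

theorem one_sub_sq_mul_derivative (hα : -1/2 < α) (hG : IsGegenbauer α G) (n : ℕ) :
    (1 - X ^ 2) * derivative (G n) = ((n : ℝ[X]) + 2 * C α) * (X * G n - G (n + 1)) := by
  induction n using Nat.twoStepInduction with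
  | zero => simp [hG.zero, hG.one]
  | one =>
    have h := hG.add_two 0
    simp only [hG.zero, hG.one, Nat.cast_zero, zero_add] at h
    simp only [hG.one, derivative_X, Nat.cast_one, Nat.reduceAdd]
    linear_combination h
  | more n ih0 ih1 =>
    have hr := hG.add_two n
    have hr' := hG.add_two (n + 1)
    have hd := congrArg derivative hr
    simp only [derivative_mul, derivative_sub, derivative_add, derivative_natCast,
      derivative_C, derivative_X, derivative_one, derivative_ofNat] at hd
    apply mul_left_cancel₀ (add_two_mul_ne_zero hα n)
    push_cast at *
    rw [show n + 1 + 2 = n + 2 + 1 from rfl, show n + 1 + 1 = n + 2 from rfl] at *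
    linear_combination (1 - X ^ 2) * hd + 2 * ((n : ℝ[X]) + 1 + C α) * X * ih1
      - ((n : ℝ[X]) + 1) * ih0 + ((n : ℝ[X]) + 1 + 2 * C α) * hr' - (n + 1 + 2 * C α) * X * hr + X * hr

theorem ode (hα : -1/2 < α) (hG : IsGegenbauer α G) (n : ℕ) :
    (1 - X ^ 2) * derivative (derivative (G n)) =
      (2 * C α + 1) * X * derivative (G n) - (n : ℝ[X]) * ((n : ℝ[X]) + 2 * C α) * G n := by
  have hX : (1 - X ^ 2 : ℝ[X]) ≠ 0 := fun h ↦ by simpa using congrArg (eval 0) h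
  have h0 := hG.one_sub_sq_mul_derivative hα n
  have h1 := hG.one_sub_sq_mul_derivative hα (n + 1)
  have hr := hG.add_two n
  have hd := congrArg derivative h0
  simp only [derivative_mul, derivative_sub, derivative_add, derivative_natCast,
    derivative_C, derivative_X, derivative_one, derivative_ofNat, derivative_X_pow] at hd
  apply mul_left_cancel₀ hX
  push_cast at *
  simp only [map_ofNat] at hd
  rw [show n + 1 + 1 = n + 2 from rfl] at *
  linear_combination (1 - X ^ 2) * hd - (n + 2 * C α) * h1 + (n + 2 * C α) * hr
    + (n + 1) * X * h0

/-- The Sonin function `n (n + 2α) G² + (1 - X²) G'²` is monotone on either side of the origin. -/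
theorem derivative_sonin (hα : -1/2 < α) (hG : IsGegenbauer α G) (n : ℕ) :
    derivative ((n : ℝ[X]) * ((n : ℝ[X]) + 2 * C α) * G n ^ 2 + (1 - X ^ 2) * derivative (G n) ^ 2) =
      4 * C α * X * derivative (G n) ^ 2 := by
  have h := hG.ode hα n
  simp only [derivative_mul, derivative_sub, derivative_add, derivative_natCast,
    derivative_C, derivative_X, derivative_one, derivative_ofNat, derivative_pow]
  push_cast
  simp only [map_ofNat]
  linear_combination 2 * derivative (G n) * h

theorem mul_sq_eval_le (hα : -1/2 < α) (hα' : α < 0) (hG : IsGegenbauer α G) (n : ℕ) {t : ℝ}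
    (ht : t ∈ Set.Icc (-1 : ℝ) 1) :
    (n : ℝ) * (n + 2 * α) * (G n).eval t ^ 2 ≤ (n : ℝ) * (n + 2 * α) * (G n).eval 0 ^ 2 +
      ((n + 2 * α) * (G (n + 1)).eval 0) ^ 2 := by
  set F : ℝ[X] :=
    (n : ℝ[X]) * ((n : ℝ[X]) + 2 * C α) * G n ^ 2 + (1 - X ^ 2) * derivative (G n) ^ 2 with hF
  have hF' : ∀ y, deriv (fun y ↦ F.eval y) y = 4 * α * y * (derivative (G n)).eval y ^ 2 :=
    fun y ↦ by
      rw [Polynomial.deriv, hF, hG.derivative_sonin hα n]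
      simp
  have hFt : (n : ℝ) * (n + 2 * α) * (G n).eval t ^ 2 ≤ F.eval t := by
    have : 0 ≤ (1 - t ^ 2) * (derivative (G n)).eval t ^ 2 :=
      mul_nonneg (by nlinarith [ht.1, ht.2]) (sq_nonneg _)
    simpa [hF] using this
  have hF0 : F.eval 0 = (n : ℝ) * (n + 2 * α) * (G n).eval 0 ^ 2 +
      ((n + 2 * α) * (G (n + 1)).eval 0) ^ 2 := by
    have h := congrArg (eval 0) (hG.one_sub_sq_mul_derivative hα n)
    simp at h
    simp [hF, h]
  rw [← hF0]
  refine hFt.trans ?_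
  rcases le_total 0 t with h0 | h0
  · refine antitoneOn_of_deriv_nonpos (convex_Icc (0 : ℝ) 1) F.continuous.continuousOn
      F.differentiable.differentiableOn (fun y hy ↦ ?_) ⟨le_rfl, zero_le_one⟩ ⟨h0, ht.2⟩ h0
    rw [interior_Icc] at hy
    rw [hF']
    exact mul_nonpos_of_nonpos_of_nonneg (by nlinarith [hy.1]) (sq_nonneg _)
  · refine monotoneOn_of_deriv_nonneg (convex_Icc (-1 : ℝ) 0) F.continuous.continuousOn
      F.differentiable.differentiableOn (fun y hy ↦ ?_) ⟨ht.1, h0⟩ ⟨by norm_num, le_rfl⟩ h0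
    rw [interior_Icc] at hy
    rw [hF']
    exact mul_nonneg (by nlinarith [hy.2]) (sq_nonneg _)

theorem natDegree_le (hα : -1/2 < α) (hG : IsGegenbauer α G) (n : ℕ) :
    (G n).natDegree ≤ n := by
  induction n using Nat.twoStepInduction with
  | zero => simp [hG.zero]
  | one => simp [hG.one]
  | more n ih0 ih1 =>
    have hk : (n : ℝ) + 1 + 2 * α ≠ 0 := by
      have := Nat.cast_nonneg (α := ℝ) n
      linarith
    have h : C ((n : ℝ) + 1 + 2 * α) * G (n + 2) =
        C (2 * ((n : ℝ) + 1 + α)) * (X * G (n + 1)) - C ((n : ℝ) + 1) * G n := by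
      simpa [C_ofNat] using hG.add_two n
    rw [← natDegree_C_mul hk, h]
    refine (natDegree_sub_le _ _).trans (max_le ?_ ?_)
    · refine (natDegree_C_mul_le _ _).trans (natDegree_mul_le.trans ?_)
      rw [natDegree_X]
      omega
    · exact (natDegree_C_mul_le _ _).trans (by omega)

theorem coeff_add_two (hα : -1/2 < α) (hG : IsGegenbauer α G) (n : ℕ) :
    ((n : ℝ) + 1 + 2 * α) * (G (n + 2)).coeff (n + 2) =
      2 * ((n : ℝ) + 1 + α) * (G (n + 1)).coeff (n + 1) := by
  have h : C ((n : ℝ) + 1 + 2 * α) * G (n + 2) =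
      C (2 * ((n : ℝ) + 1 + α)) * (X * G (n + 1)) - C ((n : ℝ) + 1) * G n := by
    simpa [C_ofNat] using hG.add_two n
  have h2 := congrArg (fun p ↦ coeff p (n + 2)) h
  simp only [coeff_sub, coeff_C_mul] at h2
  rwa [coeff_X_mul, coeff_eq_zero_of_natDegree_lt ((hG.natDegree_le hα n).trans_lt (by omega)),
    mul_zero, sub_zero] at h2

theorem coeff_pos (hα : -1/2 < α) (hG : IsGegenbauer α G) (n : ℕ) :
    0 < (G n).coeff n := by
  induction n using Nat.twoStepInduction with
  | zero => simp [hG.zero]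
  | one => simp [hG.one]
  | more n _ ih =>
    have hn := Nat.cast_nonneg (α := ℝ) n
    have h := hG.coeff_add_two hα n
    have : 0 < 2 * ((n : ℝ) + 1 + α) * (G (n + 1)).coeff (n + 1) :=
      mul_pos (by linarith) ih
    rw [← h] at this
    exact pos_of_mul_pos_right this (by linarith)

theorem exists_two_pow_mul_abs_eval_zero_le (hα : -1/2 < α) (hα' : α < 0)
    (hG : IsGegenbauer α G) :
    ∃ c : ℝ, 0 < c ∧ ∀ n, 2 ^ (n + 1) * |(G (n + 1)).eval 0| ≤ c * (G (n + 1)).coeff (n + 1) := by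
  have hK := hG.coeff_pos hα
  refine ⟨2 ^ 2 * |(G 2).eval 0| / (G 2).coeff 2 + 1, by have := hK 2; positivity, fun n ↦ ?_⟩
  set c := 2 ^ 2 * |(G 2).eval 0| / (G 2).coeff 2 + 1 with hc
  have hc0 : 0 < c := by have := hK 2; positivity
  induction n using Nat.twoStepInduction with
  | zero => simpa [hG.one] using hc0.le
  | one =>
    have h2 := hK 2
    have : 2 ^ 2 * |(G 2).eval 0| + (G 2).coeff 2 = c * (G 2).coeff 2 := by
      rw [hc]; field_simp
    change 2 ^ 2 * |(G 2).eval 0| ≤ c * (G 2).coeff 2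
    linarith
  | more n ih _ =>
    have hn := Nat.cast_nonneg (α := ℝ) n
    have hc1 := hG.coeff_add_two hα n
    have hc2 := hG.coeff_add_two hα (n + 1)
    have h0 := congrArg (eval 0) (hG.add_two (n + 1))
    simp only [eval_mul, eval_add, eval_sub, eval_natCast, eval_one, eval_C, eval_X,
      eval_ofNat] at h0
    push_cast at h0 hc1 hc2
    have habs := congrArg abs h0
    rw [zero_mul, mul_zero, zero_sub, abs_neg, abs_mul, abs_mul,
      abs_of_pos (by linarith : 0 < (n : ℝ) + 1 + 1 + 2 * α),
      abs_of_pos (by linarith : 0 < (n : ℝ) + 1 + 1)] at habs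
    rw [show n + 1 + 2 = n + 2 + 1 from rfl, show n + 1 + 1 = n + 2 from rfl] at *
    have hk1 : 0 < (n : ℝ) + 1 + 2 * α := by linarith
    have hk2 : 0 < (n : ℝ) + 1 + 1 + 2 * α := by linarith
    refine le_of_mul_le_mul_left ?_ (mul_pos hk1 hk2)
    calc ((n : ℝ) + 1 + 2 * α) * (n + 1 + 1 + 2 * α) * (2 ^ (n + 2 + 1) * |(G (n + 2 + 1)).eval 0|)
        = 4 * (((n : ℝ) + 1 + 2 * α) * (n + 1 + 1)) *
            (2 ^ (n + 1) * |(G (n + 1)).eval 0|) := by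
          rw [pow_succ (2 : ℝ) (n + 2), pow_add (2 : ℝ) n 2, pow_succ (2 : ℝ) n]
          linear_combination (8 * 2 ^ n * ((n : ℝ) + 1 + 2 * α)) * habs
      _ ≤ 4 * (((n : ℝ) + 1 + 1 + α) * (n + 1 + α)) * (c * (G (n + 1)).coeff (n + 1)) := by
          refine mul_le_mul (by nlinarith [sq_nonneg α]) ih (by positivity) ?_
          have h1 : 0 < (n : ℝ) + 1 + α := by linarith
          have h2 : 0 < (n : ℝ) + 1 + 1 + α := by linarith
          positivity
      _ = _ := by
          linear_combination (-2 * c * ((n : ℝ) + 1 + 1 + α)) * hc1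
            - c * ((n : ℝ) + 1 + 2 * α) * hc2

/-- For `-1/2 < α < 0`, the monic Gegenbauer polynomials are `O(2⁻ⁿ)` uniformly on `[-1, 1]`. -/
theorem exists_two_pow_mul_abs_eval_le (hα : -1/2 < α) (hα' : α < 0) (hG : IsGegenbauer α G) :
    ∃ c : ℝ, 0 < c ∧ ∀ n, 2 ≤ n → ∀ t ∈ Set.Icc (-1 : ℝ) 1,
      2 ^ n * |(G n).eval t| ≤ c * (G n).coeff n := by
  obtain ⟨c, hc, h⟩ := hG.exists_two_pow_mul_abs_eval_zero_le hα hα'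
  refine ⟨2 * c, by positivity, fun n hn t ht ↦ ?_⟩
  obtain ⟨m, rfl⟩ : ∃ m, n = m + 1 := ⟨n - 1, by omega⟩
  have hm : (1 : ℝ) ≤ m := by exact_mod_cast (by omega : 1 ≤ m)
  have hK := hG.coeff_pos hα (m + 1)
  have hs := hG.mul_sq_eval_le hα hα' (m + 1) ht
  have hk := hG.coeff_add_two hα m
  have h1 := h m
  have h2 := h (m + 1)
  push_cast at *
  rw [show m + 1 + 1 = m + 2 from rfl] at *
  set K := (G (m + 1)).coeff (m + 1)
  set a := (m : ℝ) + 1 + 2 * α with ha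
  have ha0 : 0 < a := by linarith
  have h1' : (2 ^ (m + 1) * (G (m + 1)).eval 0) ^ 2 ≤ (c * K) ^ 2 := by
    rw [← sq_abs, abs_mul, abs_of_pos (by positivity : (0 : ℝ) < 2 ^ (m + 1))]
    gcongr
  have h2' : (2 ^ (m + 1) * (a * (G (m + 2)).eval 0)) ^ 2 ≤ (c * (((m : ℝ) + 1 + α) * K)) ^ 2 := by
    rw [← sq_abs, abs_mul, abs_mul, abs_of_pos ha0,
      abs_of_pos (by positivity : (0 : ℝ) < 2 ^ (m + 1))]
    have := mul_le_mul_of_nonneg_left h2 ha0.le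
    rw [pow_succ (2 : ℝ) (m + 1)] at this
    refine pow_le_pow_left₀ (by positivity) ?_ 2
    linear_combination (this + c * hk) / 2
  have hl : 0 < ((m : ℝ) + 1) * a := by positivity
  have hl2 : ((m : ℝ) + 1 + α) ^ 2 ≤ 2 * (((m : ℝ) + 1) * a) := by
    rw [ha]; nlinarith
  refine abs_le_of_sq_le_sq' ?_ (by positivity) |>.2
  rw [mul_pow, sq_abs]
  refine le_of_mul_le_mul_left ?_ hl
  calc ((m : ℝ) + 1) * a * ((2 ^ (m + 1)) ^ 2 * (G (m + 1)).eval t ^ 2)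
      = (2 ^ (m + 1)) ^ 2 * (((m : ℝ) + 1) * a * (G (m + 1)).eval t ^ 2) := by ring
    _ ≤ (2 ^ (m + 1)) ^ 2 * (((m : ℝ) + 1) * a * (G (m + 1)).eval 0 ^ 2 +
          (a * (G (m + 2)).eval 0) ^ 2) := by gcongr
    _ = ((m : ℝ) + 1) * a * (2 ^ (m + 1) * (G (m + 1)).eval 0) ^ 2 +
          (2 ^ (m + 1) * (a * (G (m + 2)).eval 0)) ^ 2 := by ring
    _ ≤ ((m : ℝ) + 1) * a * (c * K) ^ 2 + (c * (((m : ℝ) + 1 + α) * K)) ^ 2 := by gcongr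
    _ = (((m : ℝ) + 1) * a + ((m : ℝ) + 1 + α) ^ 2) * (c * K) ^ 2 := by ring
    _ ≤ (((m : ℝ) + 1) * a * 4) * (c * K) ^ 2 := by gcongr; linarith
    _ = _ := by ring

theorem eq_C_coeff_mul_nodal (hα : -1/2 < α) (hG : IsGegenbauer α G) {n : ℕ} (x : Fin n → ℝ)
    (hx : Function.Injective x) (hroot : ∀ i, (G n).eval (x i) = 0) :
    G n = C ((G n).coeff n) * Lagrange.nodal Finset.univ x := by
  have hdeg : (Lagrange.nodal Finset.univ x).natDegree = n := by
    simp [Lagrange.natDegree_nodal]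
  refine eq_of_degree_sub_lt_of_eval_index_eq Finset.univ hx.injOn ?_ fun i _ ↦ ?_
  · rw [Finset.card_univ, Fintype.card_fin, degree_lt_iff_coeff_zero]
    intro m hm
    rcases hm.eq_or_lt with rfl | hm
    · have : (Lagrange.nodal Finset.univ x).coeff n = 1 := by
        have h := (Lagrange.nodal_monic (s := Finset.univ) (v := x)).coeff_natDegree
        rwa [hdeg] at h
      rw [coeff_sub, coeff_C_mul, this, mul_one, sub_self]
    · rw [coeff_sub, coeff_C_mul,
        coeff_eq_zero_of_natDegree_lt ((hG.natDegree_le hα n).trans_lt hm),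
        coeff_eq_zero_of_natDegree_lt (hdeg.trans_lt hm), mul_zero, sub_zero]
  · rw [hroot, eval_mul, Lagrange.eval_nodal_at_node (Finset.mem_univ i), mul_zero]

end IsGegenbauer

/-- Stirling's lower bound in the form `(n + 1)! ≥ n^(n + 3/2) e⁻ⁿ`. -/
theorem Nat.rpow_mul_exp_le_factorial_succ {n : ℕ} (hn : 1 ≤ n) :
    (n : ℝ) ^ ((n : ℝ) + 3/2) ≤ (n + 1).factorial * Real.exp 1 ^ n := by
  have hn0 : (0 : ℝ) < n := by exact_mod_cast hn
  have h1 : √(n : ℝ) ≤ √(2 * Real.pi * n) :=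
    Real.sqrt_le_sqrt (by nlinarith [Real.pi_gt_three])
  calc (n : ℝ) ^ ((n : ℝ) + 3/2) = n * (√n * (n / Real.exp 1) ^ n) * Real.exp 1 ^ n := by
        rw [show (n : ℝ) + 3/2 = 1 + 1/2 + n by ring, Real.rpow_add hn0, Real.rpow_add hn0,
          Real.rpow_one, Real.rpow_natCast, ← Real.sqrt_eq_rpow, div_pow]
        field_simp
    _ ≤ (n + 1) * (√(2 * Real.pi * n) * (n / Real.exp 1) ^ n) * Real.exp 1 ^ n := by
        gcongr
        linarith
    _ ≤ (n + 1) * n.factorial * Real.exp 1 ^ n := by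
        gcongr
        exact Stirling.le_factorial_stirling n
    _ = _ := by rw [Nat.factorial_succ]; push_cast; ring

/-- **Asymptotic error bound for the barycentric Gegenbauer quadrature, case `-1/2 < α < 0`.**
Let `f ∈ C^∞[-1,1]` with `‖f^{(n+1)}‖_∞ ≤ A` for all `n`, `A` independent of `n`.
For each `n`, let `x n 0 < ⋯ < x n n` be the Gegenbauer–Gauss points (zeros of `G (n+1)`)
with Lagrange basis polynomials `L n i` and `p_{B,j,i} = ∫_{-1}^{x n j} (L n i)(t) dt`.
Then there are `B > 0` and `n₀` such that for all `n ≥ n₀` and all `j`: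
`|∫_{-1}^{x n j} f - ∑ i, p_{B,j,i} f(x n i)| ≤ B (e/2)^n (x n j + 1) n^{-n - 3/2}`. -/
theorem barycentric_gegenbauer_quadrature_asymptotic_bound_neg_alpha
    (α : ℝ) (hα1 : -1/2 < α) (hα2 : α < 0)
    (f : ℝ → ℝ)
    (hf : ContDiffOn ℝ (⊤ : ℕ∞) f (Set.Icc (-1 : ℝ) 1))
    (A : ℝ) (hA : 0 < A)
    (hbound : ∀ n : ℕ, 1 ≤ n → ∀ t ∈ Set.Icc (-1 : ℝ) 1,
      |iteratedDerivWithin (n + 1) f (Set.Icc (-1 : ℝ) 1) t| ≤ A)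
    (G : ℕ → Polynomial ℝ)
    (hG0 : G 0 = 1) (hG1 : G 1 = Polynomial.X)
    (hGrec : ∀ k : ℕ, 1 ≤ k →
      Polynomial.C ((k : ℝ) + 2 * α) * G (k + 1) =
        Polynomial.C (2 * ((k : ℝ) + α)) * (Polynomial.X * G k) -
          Polynomial.C (k : ℝ) * G (k - 1))
    (x : ∀ n : ℕ, Fin (n + 1) → ℝ)
    (hx_mono : ∀ n, 1 ≤ n → StrictMono (x n))
    (hx_mem : ∀ n, 1 ≤ n → ∀ i, x n i ∈ Set.Ioo (-1 : ℝ) 1)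
    (hx_root : ∀ n, 1 ≤ n → ∀ y : ℝ, (G (n + 1)).eval y = 0 ↔ ∃ i, y = x n i)
    (L : ∀ n : ℕ, Fin (n + 1) → Polynomial ℝ)
    (hL_deg : ∀ n, 1 ≤ n → ∀ k, (L n k).natDegree ≤ n)
    (hL_eval : ∀ n, 1 ≤ n → ∀ k j,
      (L n k).eval (x n j) = if j = k then (1 : ℝ) else 0) :
    ∃ B : ℝ, 0 < B ∧ ∃ n₀ : ℕ, 1 ≤ n₀ ∧
      ∀ n, n₀ ≤ n → ∀ j : Fin (n + 1),
        |(∫ t in (-1 : ℝ)..(x n j), f t) -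
            ∑ i : Fin (n + 1), (∫ t in (-1 : ℝ)..(x n j), (L n i).eval t) * f (x n i)| ≤
          B * (Real.exp 1 / 2) ^ n * (x n j + 1) *
            (n : ℝ) ^ (-(n : ℝ) - 3/2) := by
  have hGeg : IsGegenbauer α G := ⟨hG0, hG1, hGrec⟩
  obtain ⟨c, hc, hsup⟩ := hGeg.exists_two_pow_mul_abs_eval_le hα1 hα2
  refine ⟨A * c, by positivity, 1, le_rfl, fun n hn j ↦ ?_⟩
  have hn0 : (0 : ℝ) < n := by exact_mod_cast hn
  have hinj := (hx_mono n hn).injective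
  have hmem : ∀ i, x n i ∈ Set.Icc (-1 : ℝ) 1 := fun i ↦ Set.Ioo_subset_Icc_self (hx_mem n hn i)
  have hnodal : ∀ t ∈ Set.Icc (-1 : ℝ) 1,
      |(Lagrange.nodal Finset.univ (x n)).eval t| ≤ c / 2 ^ (n + 1) := fun t ht ↦ by
    have hK := hGeg.coeff_pos hα1 (n + 1)
    have h := hsup (n + 1) (by omega) t ht
    rw [hGeg.eq_C_coeff_mul_nodal hα1 (x n) hinj fun i ↦ (hx_root n hn _).2 ⟨i, rfl⟩,
      Polynomial.eval_mul, Polynomial.eval_C, abs_mul, abs_of_pos hK,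
      ← hGeg.eq_C_coeff_mul_nodal hα1 (x n) hinj fun i ↦ (hx_root n hn _).2 ⟨i, rfl⟩] at h
    rw [le_div_iff₀ (by positivity)]
    refine le_of_mul_le_mul_left ?_ hK
    linarith
  set p : Polynomial ℝ := ∑ i, Polynomial.C (f (x n i)) * L n i with hp
  have hp_deg : p.natDegree ≤ n := Polynomial.natDegree_sum_le_of_forall_le _ _ fun i _ ↦
    (Polynomial.natDegree_C_mul_le _ _).trans (hL_deg n hn i)
  have hp_eval : ∀ i, p.eval (x n i) = f (x n i) := fun i ↦ by
    simp [hp, Polynomial.eval_finsetSum, hL_eval n hn]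
  have herr : ∀ t ∈ Set.Icc (-1 : ℝ) 1,
      |f t - p.eval t| ≤ A * c * (Real.exp 1 / 2) ^ n * (n : ℝ) ^ (-(n : ℝ) - 3/2) :=
      fun t ht ↦ by
    obtain ⟨ξ, hξ, h⟩ := exists_sub_eval_eq_iteratedDerivWithin_mul_nodal (by norm_num) n f
      (hf.of_le (by exact_mod_cast le_top)) (x n) hinj hmem p hp_deg hp_eval ht
    have hfac : (0 : ℝ) < (n + 1).factorial := by positivity
    have h1 : |f t - p.eval t| * (n + 1).factorial ≤ A * (c / 2 ^ (n + 1)) := by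
      rw [← abs_of_pos hfac, ← abs_mul, h, abs_mul]
      exact mul_le_mul (hbound n hn ξ hξ) (hnodal t ht) (abs_nonneg _) hA.le
    have hst := Nat.rpow_mul_exp_le_factorial_succ hn
    rw [show -(n : ℝ) - 3/2 = -((n : ℝ) + 3/2) by ring, Real.rpow_neg hn0.le]
    have hpow : 0 < (n : ℝ) ^ ((n : ℝ) + 3/2) := Real.rpow_pos_of_pos hn0 _
    calc |f t - p.eval t| ≤ A * (c / 2 ^ (n + 1)) / (n + 1).factorial := by
          rwa [le_div_iff₀ hfac]
      _ ≤ A * (c / 2 ^ n) / (n + 1).factorial := by gcongr <;> norm_num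
      _ ≤ A * (c / 2 ^ n) * (Real.exp 1 ^ n / (n : ℝ) ^ ((n : ℝ) + 3/2)) := by
          rw [div_eq_mul_inv]
          gcongr
          rw [inv_eq_one_div, div_le_div_iff₀ hfac hpow]
          linarith
      _ = _ := by rw [div_pow]; ring
  have hsub : Set.Icc (-1 : ℝ) (x n j) ⊆ Set.Icc (-1 : ℝ) 1 :=
    Set.Icc_subset_Icc_right (hmem j).2
  have hf_int : IntervalIntegrable f MeasureTheory.volume (-1) (x n j) :=
    (hf.continuousOn.mono (by rwa [Set.uIcc_of_le (hmem j).1])).intervalIntegrable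
  have hsum : ∑ i, (∫ t in (-1 : ℝ)..(x n j), (L n i).eval t) * f (x n i) =
      ∫ t in (-1 : ℝ)..(x n j), p.eval t := by
    simp only [hp, Polynomial.eval_finsetSum, Polynomial.eval_mul, Polynomial.eval_C]
    rw [intervalIntegral.integral_finsetSum fun i _ ↦
      ((L n i).continuous.intervalIntegrable _ _).const_mul _]
    simp [mul_comm]
  rw [hsum, ← intervalIntegral.integral_sub hf_int (p.continuous.intervalIntegrable _ _),
    ← Real.norm_eq_abs]
  refine (intervalIntegral.norm_integral_le_of_norm_le_const
    (C := A * c * (Real.exp 1 / 2) ^ n * (n : ℝ) ^ (-(n : ℝ) - 3/2)) fun t ht ↦ ?_).trans_eq ?_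
  · rw [Set.uIoc_of_le (hmem j).1] at ht
    exact herr t (hsub (Set.Ioc_subset_Icc_self ht))
  · rw [abs_of_nonneg (by linarith [(hmem j).1])]
    ring
end
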